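/- Define g : ℝ → ℝ by g(θ) = cos θ + sin θ − 1, and for ε ∈ (0,1/2] define ũ_ε(r,θ) = g(θ)·(1 − r(cos θ + sin θ))/(1 − ε(cos θ + sin θ)). Then there exists a constant C > 0, independent of ε, such that for all ε ∈ (0,1/2], ∫_ε^1 ∫_0^{π/2} [ (∂ũ_ε/∂r(r,θ))² + r^{−2}·(∂ũ_ε/∂θ(r,θ))² ] · r dθ dr ≤ C·(1 + |log ε|). -/

import Mathlib

open Real Set MeasureTheory intervalIntegral

/-- The comparison function `ũ_ε(r,θ) = g(θ)·(1 − r(cos θ + sin θ))/(1 − ε(cos θ + sin θ))`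
with `g(θ) = cos θ + sin θ − 1`, written in polar coordinates. -/
noncomputable def uTilde (ε r θ : ℝ) : ℝ :=
  (Real.cos θ + Real.sin θ - 1) * (1 - r * (Real.cos θ + Real.sin θ)) /
    (1 - ε * (Real.cos θ + Real.sin θ))

lemma abs_cos_add_sin_le (θ : ℝ) : |cos θ + sin θ| ≤ 3 / 2 :=
  abs_le_of_sq_le_sq (by nlinarith [sin_sq_add_cos_sq θ, sq_nonneg (cos θ - sin θ)]) (by norm_num)

lemma abs_cos_sub_sin_le (θ : ℝ) : |cos θ - sin θ| ≤ 3 / 2 :=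
  abs_le_of_sq_le_sq (by nlinarith [sin_sq_add_cos_sq θ, sq_nonneg (cos θ + sin θ)]) (by norm_num)

lemma one_fourth_le_denom {ε : ℝ} (hε : ε ∈ Ioc (0 : ℝ) (1 / 2)) (θ : ℝ) :
    1 / 4 ≤ 1 - ε * (cos θ + sin θ) := by
  have h := (abs_le.mp (abs_cos_add_sin_le θ)).2
  nlinarith [hε.1, hε.2]

lemma hasDerivAt_uTilde_radial (ε r θ : ℝ) :
    HasDerivAt (fun r' => uTilde ε r' θ)
      ((cos θ + sin θ - 1) * (-(cos θ + sin θ)) / (1 - ε * (cos θ + sin θ))) r := by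
  unfold uTilde
  have h := ((hasDerivAt_id r).mul_const (cos θ + sin θ)).const_sub 1
  simpa using (h.const_mul (cos θ + sin θ - 1)).div_const (1 - ε * (cos θ + sin θ))

lemma hasDerivAt_uTilde_angular {ε : ℝ} (r θ : ℝ) (hD : 1 - ε * (cos θ + sin θ) ≠ 0) :
    HasDerivAt (fun θ' => uTilde ε r θ')
      ((cos θ - sin θ) * ((1 - r * (cos θ + sin θ)) - (cos θ + sin θ - 1) * r) /
          (1 - ε * (cos θ + sin θ)) +
        (cos θ + sin θ - 1) * (1 - r * (cos θ + sin θ)) * ε * (cos θ - sin θ) /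
          (1 - ε * (cos θ + sin θ)) ^ 2) θ := by
  unfold uTilde
  have hs : HasDerivAt (fun t => cos t + sin t) (-sin θ + cos θ) θ :=
    (hasDerivAt_cos θ).add (hasDerivAt_sin θ)
  have h := ((hs.sub_const 1).mul ((hs.const_mul r).const_sub 1)).div
    ((hs.const_mul ε).const_sub 1) hD
  refine h.congr_deriv ?_
  simp only [Pi.mul_apply]
  field_simp
  ring

lemma abs_deriv_uTilde_radial_le {ε : ℝ} (hε : ε ∈ Ioc (0 : ℝ) (1 / 2)) (r θ : ℝ) :
    |deriv (fun r' => uTilde ε r' θ) r| ≤ 15 := by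
  rw [(hasDerivAt_uTilde_radial ε r θ).deriv]
  have hD := one_fourth_le_denom hε θ
  have hs := abs_cos_add_sin_le θ
  have hg : |cos θ + sin θ - 1| ≤ 5 / 2 := by
    rw [abs_le] at hs ⊢
    constructor <;> linarith
  rw [abs_div, abs_mul, abs_neg, abs_of_pos (by linarith : 0 < 1 - ε * (cos θ + sin θ))]
  calc |cos θ + sin θ - 1| * |cos θ + sin θ| / (1 - ε * (cos θ + sin θ))
      ≤ (5 / 2) * (3 / 2) / (1 / 4) := by gcongr
    _ = 15 := by norm_num

lemma abs_deriv_uTilde_angular_le {ε r : ℝ} (hε : ε ∈ Ioc (0 : ℝ) (1 / 2))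
    (hr : r ∈ Icc (0 : ℝ) 1) (θ : ℝ) :
    |deriv (fun θ' => uTilde ε r θ') θ| ≤ 105 := by
  have hD := one_fourth_le_denom hε θ
  have hD0 : 0 < 1 - ε * (cos θ + sin θ) := by linarith
  rw [(hasDerivAt_uTilde_angular r θ hD0.ne').deriv]
  have hs' := abs_cos_sub_sin_le θ
  have hs := abs_le.mp (abs_cos_add_sin_le θ)
  obtain ⟨hr0, hr1⟩ := hr
  have hg : |cos θ + sin θ - 1| ≤ 5 / 2 := by
    rw [abs_le]
    constructor <;> linarith
  have hl : |1 - r * (cos θ + sin θ)| ≤ 5 / 2 := by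
    rw [abs_le]
    constructor <;> nlinarith
  have hd : |(1 - r * (cos θ + sin θ)) - (cos θ + sin θ - 1) * r| ≤ 5 := by
    rw [abs_le]
    constructor <;> nlinarith
  have hε2 : |ε| ≤ 1 / 2 := by rw [abs_of_pos hε.1]; exact hε.2
  refine (abs_add_le _ _).trans ?_
  rw [abs_div, abs_div, abs_pow, abs_of_pos hD0]
  simp only [abs_mul]
  calc _ ≤ (3 / 2) * 5 / (1 / 4) + (5 / 2) * (5 / 2) * (1 / 2) * (3 / 2) / (1 / 4 : ℝ) ^ 2 := by
        gcongr
    _ ≤ 105 := by norm_num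

lemma abs_energy_density_le {ε r : ℝ} (hε : ε ∈ Ioc (0 : ℝ) (1 / 2))
    (hr : r ∈ Ioc (0 : ℝ) 1) (θ : ℝ) :
    |((deriv (fun r' => uTilde ε r' θ) r) ^ 2
      + (deriv (fun θ' => uTilde ε r θ') θ) ^ 2 / r ^ 2) * r| ≤ 11250 * r⁻¹ := by
  obtain ⟨hr0, hr1⟩ := hr
  have h1 := sq_le_sq' (abs_le.mp (abs_deriv_uTilde_radial_le hε r θ)).1
    (abs_le.mp (abs_deriv_uTilde_radial_le hε r θ)).2
  have h2' := abs_le.mp (abs_deriv_uTilde_angular_le hε ⟨hr0.le, hr1⟩ θ)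
  have h2 := sq_le_sq' h2'.1 h2'.2
  have hrr : r ≤ r⁻¹ := hr1.trans ((one_le_inv₀ hr0).mpr hr1)
  rw [abs_of_nonneg (by positivity)]
  calc _ ≤ ((15 : ℝ) ^ 2 + 105 ^ 2 / r ^ 2) * r := by gcongr
    _ = 225 * r + 11025 * r⁻¹ := by field_simp; ring
    _ ≤ 11250 * r⁻¹ := by linarith

/-- The polar Dirichlet energy of `ũ_ε` on `[ε,1] × [0,π/2]` is bounded by
`C (1 + |log ε|)` uniformly in `ε ∈ (0,1/2]`. -/
theorem stmt_11 :
    ∃ C : ℝ, 0 < C ∧ ∀ ε : ℝ, ε ∈ Ioc (0:ℝ) (1/2) →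
      ∫ r in ε..1, ∫ θ in (0:ℝ)..(π/2),
          ((deriv (fun r' => uTilde ε r' θ) r) ^ 2
            + (deriv (fun θ' => uTilde ε r θ') θ) ^ 2 / r ^ 2) * r
        ≤ C * (1 + |Real.log ε|) := by
  refine ⟨11250 * (π / 2), by positivity, fun ε hε => ?_⟩
  have hε1 : ε ≤ 1 := hε.2.trans (by norm_num)
  have hinner : ∀ r ∈ Ioc ε 1, ‖∫ θ in (0:ℝ)..(π/2),
      ((deriv (fun r' => uTilde ε r' θ) r) ^ 2
        + (deriv (fun θ' => uTilde ε r θ') θ) ^ 2 / r ^ 2) * r‖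
      ≤ 11250 * (π / 2) * r⁻¹ := fun r hr => by
    refine (intervalIntegral.norm_integral_le_of_norm_le_const
      fun θ _ => abs_energy_density_le hε ⟨hε.1.trans hr.1, hr.2⟩ θ).trans (le_of_eq ?_)
    rw [sub_zero, abs_of_pos (by positivity)]
    ring
  have hint : IntervalIntegrable (fun r : ℝ => 11250 * (π / 2) * r⁻¹) volume ε 1 := by
    refine (intervalIntegral.intervalIntegrable_inv (fun r hr => ?_) continuousOn_id).const_mul _
    rw [uIcc_of_le hε1] at hr
    exact (hε.1.trans_le hr.1).ne'
  refine (le_abs_self _).trans ((intervalIntegral.norm_integral_le_of_norm_le hε1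
    (Filter.Eventually.of_forall hinner) hint).trans ?_)
  rw [intervalIntegral.integral_const_mul, integral_inv_of_pos hε.1 one_pos, one_div, log_inv]
  gcongr
  linarith [neg_le_abs (log ε)]
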